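/- Suppose G contains a contracting element and ω_G < ∞. Then for every y ∈ Y there exists an ω_G-dimensional G-equivariant conformal density {μ_x}_{x∈Y} on ∂_hY which is supported on the limit set ΛGy, the set of accumulation points of the orbit Gy in ∂_hY. -/

import Mathlib

open Metric Filter Topology Set MeasureTheory Pointwise

noncomputable section

namespace ConfDyn

/-- `γ` is (the image of) a geodesic segment from `x` to `y`. -/
def IsGeodesicIn (Y : Type*) [MetricSpace Y] (γ : Set Y) (x y : Y) : Prop :=
  ∃ f : ℝ → Y, f 0 = x ∧ f (dist x y) = y ∧
    (∀ s ∈ Set.Icc (0 : ℝ) (dist x y), ∀ t ∈ Set.Icc (0 : ℝ) (dist x y),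
      dist (f s) (f t) = |s - t|) ∧
    γ = f '' Set.Icc (0 : ℝ) (dist x y)

/-- `Y` is a geodesic metric space. -/
def GeodesicSpace (Y : Type*) [MetricSpace Y] : Prop :=
  ∀ x y : Y, ∃ γ : Set Y, IsGeodesicIn Y γ x y

/-- the shortest projection of the point `y` to the subset `X`. -/
def projSet {Y : Type*} [MetricSpace Y] (X : Set Y) (y : Y) : Set Y :=
  {x ∈ X | dist y x = Metric.infDist y X}

/-- the shortest projection of the subset `A` to the subset `X`. -/
def projSetOf {Y : Type*} [MetricSpace Y] (X A : Set Y) : Set Y :=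
  ⋃ a ∈ A, projSet X a

/-- `d_X(x,y)`, the diameter of `π_X(x) ∪ π_X(y)`. -/
def projDist {Y : Type*} [MetricSpace Y] (X : Set Y) (x y : Y) : ENNReal :=
  EMetric.diam (projSet X x ∪ projSet X y)

/-- `X` is a `C`-contracting subset: any geodesic segment at distance at least `C`
from `X` has shortest projection to `X` of diameter at most `C`. -/
def IsContractingSet {Y : Type*} [MetricSpace Y] (C : ℝ) (X : Set Y) : Prop :=
  ∀ x y : Y, ∀ γ : Set Y, IsGeodesicIn Y γ x y →
    (∀ p ∈ γ, C ≤ Metric.infDist p X) →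
    EMetric.diam (projSetOf X γ) ≤ ENNReal.ofReal C

/-- the Busemann function based at `o` associated to `y`, `b_y(x) = d(x,y) - d(o,y)`. -/
def busemannCM {Y : Type*} [MetricSpace Y] (o y : Y) : C(Y, ℝ) :=
  ⟨fun x => dist x y - dist o y,
    (continuous_id.dist continuous_const).sub continuous_const⟩

/-- the horofunction compactification of `Y`: the closure of `{b_y : y ∈ Y}` in
`C(Y,ℝ)` with the compact-open topology. -/
def horoCpt (Y : Type*) [MetricSpace Y] (o : Y) : Set C(Y, ℝ) :=
  closure (Set.range (busemannCM o))

/-- `ξ` is a point of the horofunction boundary `∂_h Y`. -/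
def IsHoroPoint {Y : Type*} [MetricSpace Y] (o : Y) (ξ : C(Y, ℝ)) : Prop :=
  ξ ∈ horoCpt Y o ∧ ∀ y : Y, ξ ≠ busemannCM o y

/-- a sequence of points of `Y` converges to `ξ` in the horofunction compactification. -/
def HoroConv {Y : Type*} [MetricSpace Y] (o : Y) (u : ℕ → Y) (ξ : C(Y, ℝ)) : Prop :=
  Filter.Tendsto (fun n => busemannCM o (u n)) atTop (nhds ξ)

/-- two horofunctions have (K-)finite difference for some K. -/
def FinDiff {Y : Type*} [MetricSpace Y] (ξ η : C(Y, ℝ)) : Prop :=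
  ∃ K : ℝ, ∀ z : Y, |ξ z - η z| ≤ K

/-- the locus of a subset of the horofunction boundary. -/
def locus {Y : Type*} [MetricSpace Y] (o : Y) (Λ : Set C(Y, ℝ)) : Set C(Y, ℝ) :=
  {η | IsHoroPoint o η ∧ ∃ ξ ∈ Λ, FinDiff ξ η}

/-- the finite-difference relation as a setoid on `C(Y,ℝ)`. -/
def finDiffSetoid (Y : Type*) [MetricSpace Y] : Setoid C(Y, ℝ) where
  r := FinDiff
  iseqv := ⟨fun ξ => ⟨0, fun z => by simp⟩,
    fun h => h.imp (fun K hK z => by rw [abs_sub_comm]; exact hK z),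
    fun h₁ h₂ => by
      obtain ⟨K₁, hK₁⟩ := h₁
      obtain ⟨K₂, hK₂⟩ := h₂
      exact ⟨K₁ + K₂, fun z => (abs_sub_le _ _ _).trans (add_le_add (hK₁ z) (hK₂ z))⟩⟩

/-- the limit set of a subset `X ⊆ Y` in the horofunction boundary. -/
def limitSetOf {Y : Type*} [MetricSpace Y] (o : Y) (X : Set Y) : Set C(Y, ℝ) :=
  {ξ | IsHoroPoint o ξ ∧ ∃ u : ℕ → Y, (∀ n, u n ∈ X) ∧ HoroConv o u ξ}

/-- accumulation points of a sequence of points of `Y` in the horofunction boundary. -/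
def accPoints {Y : Type*} [MetricSpace Y] (o : Y) (u : ℕ → Y) : Set C(Y, ℝ) :=
  {ξ | IsHoroPoint o ξ ∧ ∃ φ : ℕ → ℕ, StrictMono φ ∧ HoroConv o (u ∘ φ) ξ}

/-- `X` is a quasi-geodesic: the image of a quasi-isometric embedding of a real interval. -/
def IsQuasiGeodesicSet {Y : Type*} [MetricSpace Y] (X : Set Y) : Prop :=
  ∃ (c : ℝ) (I : Set ℝ) (φ : ℝ → Y), 1 ≤ c ∧ I.OrdConnected ∧ X = φ '' I ∧
    ∀ s ∈ I, ∀ t ∈ I,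
      (1 / c) * |s - t| - c ≤ dist (φ s) (φ t) ∧ dist (φ s) (φ t) ≤ c * |s - t| + c

section GroupAction

variable {Y : Type*} [MetricSpace Y] {G : Type*} [Group G] [MulAction G Y]

/-- `G` acts by isometries on `Y`. -/
def IsometricAction (G Y : Type*) [Group G] [MulAction G Y] [MetricSpace Y] : Prop :=
  ∀ g : G, Isometry (fun y : Y => g • y)

/-- the action of `G` on `Y` is (metrically) proper. -/
def ProperAction (G Y : Type*) [Group G] [MulAction G Y] [MetricSpace Y] : Prop :=
  ∀ B : Set Y, Bornology.IsBounded B → Set.Finite {g : G | (g • B) ∩ B ≠ ∅}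

/-- `G` is non-elementary: no finite-index subgroup is trivial or infinite cyclic. -/
def NonElementary (G : Type*) [Group G] : Prop :=
  ∀ H : Subgroup G, H.index ≠ 0 → ∀ g : G, H ≠ Subgroup.zpowers g

/-- the orbit of `o` under the cyclic group generated by `f`. -/
def cyclicOrbit (o : Y) (f : G) : Set Y :=
  {y : Y | ∃ n : ℤ, y = f ^ n • o}

/-- `f` is a contracting element with `C`-contracting orbit: it has infinite order,
`n ↦ fⁿ • o` is a quasi-isometric embedding of `ℤ`, and `⟨f⟩ • o` is `C`-contracting. -/
def IsContractingElt (o : Y) (C : ℝ) (f : G) : Prop :=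
  (∀ n : ℤ, n ≠ 0 → f ^ n ≠ 1) ∧
  (∃ c : ℝ, 1 ≤ c ∧ ∀ m n : ℤ,
      (1 / c) * |(m : ℝ) - (n : ℝ)| - c ≤ dist (f ^ m • o) (f ^ n • o) ∧
      dist (f ^ m • o) (f ^ n • o) ≤ c * |(m : ℝ) - (n : ℝ)| + c) ∧
  IsContractingSet C (cyclicOrbit o f)

/-- `f` is a contracting element. -/
def IsContractingEltAny (o : Y) (f : G) : Prop :=
  ∃ C : ℝ, 1 ≤ C ∧ IsContractingElt o C f

/-- the elementary group `E(f)`: elements moving `⟨f⟩ • o` a finite Hausdorff distance. -/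
def EGroup (o : Y) (f : G) : Set G :=
  {g : G | EMetric.hausdorffEdist (g • cyclicOrbit o f) (cyclicOrbit o f) ≠ ⊤}

/-- the axis `Ax(f) = E(f) • o`. -/
def axisOf (o : Y) (f : G) : Set Y :=
  (fun g : G => g • o) '' EGroup o f

/-- the family of all `G`-translated axes of `h` and `k`. -/
def axesPairFam (o : Y) (h k : G) : Set (Set Y) :=
  {S | ∃ g : G, S = g • axisOf o h ∨ S = g • axisOf o k}

/-- `h` and `k` are independent contracting elements: the family of their translated
axes has bounded projection. -/
def IndepElts (o : Y) (h k : G) : Prop :=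
  ∃ B : ℝ, 0 < B ∧ ∀ U ∈ axesPairFam o h k, ∀ V ∈ axesPairFam o h k,
    U ≠ V → EMetric.diam (projSetOf U V) ≤ ENNReal.ofReal B

/-- the family of all `G`-translated axes of the triple `f₁, f₂, f₃`. -/
def axesTripleFam (o : Y) (f₁ f₂ f₃ : G) : Set (Set Y) :=
  {S | ∃ g : G, S = g • axisOf o f₁ ∨ S = g • axisOf o f₂ ∨ S = g • axisOf o f₃}

/-- `F = {f₁,f₂,f₃}` is an admissible triple with constants `C`, `B₀`: three pairwise
independent contracting elements whose translated axes are `C`-contracting with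
`B₀`-bounded projection. -/
def IsAdmissibleTriple (o : Y) (C B₀ : ℝ) (f₁ f₂ f₃ : G) : Prop :=
  f₁ ≠ f₂ ∧ f₁ ≠ f₃ ∧ f₂ ≠ f₃ ∧
  IsContractingEltAny o f₁ ∧ IsContractingEltAny o f₂ ∧ IsContractingEltAny o f₃ ∧
  IndepElts o f₁ f₂ ∧ IndepElts o f₁ f₃ ∧ IndepElts o f₂ f₃ ∧
  (∀ S ∈ axesTripleFam o f₁ f₂ f₃, IsContractingSet C S) ∧
  (∀ U ∈ axesTripleFam o f₁ f₂ f₃, ∀ V ∈ axesTripleFam o f₁ f₂ f₃,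
    U ≠ V → EMetric.diam (projSetOf U V) ≤ ENNReal.ofReal B₀)

/-- the geodesic `γ` contains an `(r,f)`-barrier at `g • o`. -/
def HasBarrier (o : Y) (r : ℝ) (f g : G) (γ : Set Y) : Prop :=
  Metric.infDist (g • o) γ ≤ r ∧ Metric.infDist ((g * f) • o) γ ≤ r

/-- the partial cone `Ω_x^F(g • o, r)`. -/
def partialCone (o x : Y) (f₁ f₂ f₃ : G) (g : G) (r : ℝ) : Set Y :=
  {z | ∃ γ : Set Y, IsGeodesicIn Y γ x z ∧
      (HasBarrier o r f₁ g γ ∨ HasBarrier o r f₂ g γ ∨ HasBarrier o r f₃ g γ)}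

/-- the partial shadow `Π_x^F(g • o, r)`: accumulation points of the partial cone in
the horofunction boundary. -/
def partialShadow (o x : Y) (f₁ f₂ f₃ : G) (g : G) (r : ℝ) : Set C(Y, ℝ) :=
  {ξ | IsHoroPoint o ξ ∧ ∃ u : ℕ → Y, (∀ n, u n ∈ partialCone o x f₁ f₂ f₃ g r) ∧
      HoroConv o u ξ}

/-- `ξ` is an `(r,F)`-conical point. -/
def IsConicalPt (o : Y) (f₁ f₂ f₃ : G) (r : ℝ) (ξ : C(Y, ℝ)) : Prop :=
  ∃ g₀ : G, Set.Infinite {g : G | ξ ∈ partialShadow o (g₀ • o) f₁ f₂ f₃ g r}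

/-- the usual cone `Ω_x(y,r)`. -/
def usualCone (x y : Y) (r : ℝ) : Set Y :=
  {z | ∃ γ : Set Y, IsGeodesicIn Y γ x z ∧ ∃ p ∈ γ, dist p y ≤ r}

/-- the usual shadow `Π_x(y,r)`. -/
def usualShadow (o x y : Y) (r : ℝ) : Set C(Y, ℝ) :=
  {ξ | IsHoroPoint o ξ ∧ ∃ u : ℕ → Y, (∀ n, u n ∈ usualCone x y r) ∧ HoroConv o u ξ}

/-- the set `Λ_c(G)` of conical points of the action. -/
def conicalSet (G : Type*) {Y : Type*} [Group G] [MulAction G Y] [MetricSpace Y]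
    (o : Y) : Set C(Y, ℝ) :=
  {ξ | ∃ r : ℝ, 0 < r ∧ ∃ g₀ : G, ∃ u : ℕ → G,
      Filter.Tendsto (fun n => dist o (u n • o)) atTop atTop ∧
      ∀ n, ξ ∈ usualShadow o (g₀ • o) (u n • o) r}

/-- the attracting fixed-point set `[h⁺]`: the locus of the accumulation points of
`{hⁿ o : n > 0}` in the horofunction boundary. -/
def attrFix (o : Y) (h : G) : Set C(Y, ℝ) :=
  locus o (accPoints o (fun n : ℕ => h ^ (n + 1) • o))

/-- the repelling fixed-point set `[h⁻]`. -/
def repFix (o : Y) (h : G) : Set C(Y, ℝ) :=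
  locus o (accPoints o (fun n : ℕ => h ^ (-(n + 1) : ℤ) • o))

/-- the limit set `Λ G y` of the orbit `G • y` in the horofunction boundary. -/
def orbitLimitSet (G : Type*) {Y : Type*} [Group G] [MulAction G Y] [MetricSpace Y]
    (o y : Y) : Set C(Y, ℝ) :=
  {ξ | IsHoroPoint o ξ ∧ ∃ u : ℕ → G,
      Filter.Tendsto (fun n => busemannCM o (u n • y)) atTop (nhds ξ)}

/-- the action of an isometry `g` on horofunctions. -/
def horoAct [ContinuousConstSMul G Y] (o : Y) (g : G) (ξ : C(Y, ℝ)) : C(Y, ℝ) :=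
  ⟨fun y => ξ (g⁻¹ • y) - ξ (g⁻¹ • o),
    (ξ.continuous.comp (continuous_const_smul g⁻¹)).sub continuous_const⟩

/-- the number of orbit points of `Γ ⊆ G` in the closed ball of radius `R` around `o`. -/
def orbitCount (G : Type*) {Y : Type*} [Group G] [MulAction G Y] [MetricSpace Y]
    (o : Y) (Γ : Set G) (R : ℝ) : ℕ :=
  Nat.card {g : G // g ∈ Γ ∧ dist o (g • o) ≤ R}

/-- the critical exponent `ω_Γ` of a subset `Γ ⊆ G`. -/
def critExp (G : Type*) {Y : Type*} [Group G] [MulAction G Y] [MetricSpace Y]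
    (o : Y) (Γ : Set G) : ℝ :=
  Filter.limsup (fun R : ℝ => Real.log (orbitCount G o Γ R) / R) atTop

/-- an `ω`-dimensional `G`-equivariant conformal density on the horofunction boundary:
a family of finite measures supported on `∂_h Y`, normalized at `o`, `G`-equivariant,
with conformal derivative `dμ_x/dμ_y(ξ) = e^{-ω·B_ξ(x,y)}`. -/
def IsConformalDensity (G : Type*) {Y : Type*} [Group G] [MulAction G Y] [MetricSpace Y]
    [ContinuousConstSMul G Y] [MeasurableSpace C(Y, ℝ)]
    (o : Y) (ω : ℝ) (μ : Y → MeasureTheory.Measure C(Y, ℝ)) : Prop :=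
  (∀ x : Y, MeasureTheory.IsFiniteMeasure (μ x)) ∧
  (∀ x : Y, μ x {ξ : C(Y, ℝ) | ¬ IsHoroPoint o ξ} = 0) ∧
  μ o Set.univ = 1 ∧
  (∀ g : G, ∀ x : Y, MeasureTheory.Measure.map (horoAct o g) (μ x) = μ (g • x)) ∧
  (∀ x y : Y, μ x = (μ y).withDensity
      (fun ξ : C(Y, ℝ) => ENNReal.ofReal (Real.exp (-ω * (ξ x - ξ y)))))

end GroupAction

section PattersonSullivan

/-! ### The horofunction compactification -/

lemma horoCpt_subset {Y : Type*} [MetricSpace Y] (o : Y) :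
    horoCpt Y o ⊆ {f : C(Y, ℝ) | f o = 0 ∧ ∀ x z, |f x - f z| ≤ dist x z} := by
  refine closure_minimal ?_ ?_
  · rintro _ ⟨y, rfl⟩
    refine ⟨by simp [busemannCM], fun x z => ?_⟩
    simpa [busemannCM] using abs_dist_sub_le x z y
  · simp only [Set.ofPred_and, Set.ofPred_forall]
    refine IsClosed.inter (isClosed_eq (by fun_prop) continuous_const) ?_
    exact isClosed_iInter fun x => isClosed_iInter fun z =>
      isClosed_le (by fun_prop) continuous_const

lemma isCompact_horoCpt {Y : Type*} [MetricSpace Y] (o : Y) : IsCompact (horoCpt Y o) := by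
  refine IsCompact.of_isClosed_subset ?_ isClosed_closure (horoCpt_subset o)
  refine ArzelaAscoli.isCompact_of_equicontinuous _ ?_ ?_
  · have himage : ContinuousMap.toFun '' {f : C(Y, ℝ) | f o = 0 ∧ ∀ x z, |f x - f z| ≤ dist x z}
        = {f : Y → ℝ | f o = 0 ∧ ∀ x z, |f x - f z| ≤ dist x z} := by
      ext f
      constructor
      · rintro ⟨f, hf, rfl⟩
        exact hf
      · intro hf
        have hL : LipschitzWith 1 f := LipschitzWith.of_dist_le_mul fun x z => by
          simpa [Real.dist_eq] using hf.2 x z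
        exact ⟨⟨f, hL.continuous⟩, hf, rfl⟩
    rw [himage]
    refine IsCompact.of_isClosed_subset
      (isCompact_univ_pi fun x : Y => isCompact_Icc (a := -dist x o) (b := dist x o)) ?_ ?_
    · simp only [Set.ofPred_and, Set.ofPred_forall]
      refine IsClosed.inter (isClosed_eq (by fun_prop) continuous_const) ?_
      exact isClosed_iInter fun x => isClosed_iInter fun z =>
        isClosed_le (by fun_prop) continuous_const
    · intro f hf x _
      have := hf.2 x o
      rw [hf.1, sub_zero] at this
      exact abs_le.1 this
  · intro x
    rw [Metric.equicontinuousAt_iff]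
    intro ε hε
    refine ⟨ε, hε, fun z hz f => ?_⟩
    rw [Real.dist_eq]
    exact (f.2.2 x z).trans_lt (by rwa [dist_comm])

/-- Since `Y` is geodesic, a sequence escaping to infinity cannot converge to a point of `Y`. -/
lemma ne_busemannCM_of_horoConv {Y : Type*} [MetricSpace Y] [ProperSpace Y]
    (hY : GeodesicSpace Y) {o : Y} {u : ℕ → Y} {ξ : C(Y, ℝ)}
    (hu : Tendsto (fun n => dist o (u n)) atTop atTop) (hξ : HoroConv o u ξ) (z : Y) :
    ξ ≠ busemannCM o z := by
  rintro rfl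
  have hunif := ContinuousMap.tendsto_iff_forall_isCompact_tendstoUniformlyOn.1 hξ _
    (isCompact_closedBall z 1)
  obtain ⟨n, hn, hfar⟩ := ((Metric.tendstoUniformlyOn_iff.1 hunif (1 / 2) (by norm_num)).and
    (hu.eventually_ge_atTop (dist o z + 1))).exists
  have hd : 1 ≤ dist z (u n) := by linarith [dist_triangle o z (u n)]
  obtain ⟨-, f, h0, h1, hf, -⟩ := hY z (u n)
  have m0 : (0 : ℝ) ∈ Set.Icc (0 : ℝ) (dist z (u n)) := ⟨le_rfl, dist_nonneg⟩
  have m1 : (1 : ℝ) ∈ Set.Icc (0 : ℝ) (dist z (u n)) := ⟨zero_le_one, hd⟩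
  have m2 : dist z (u n) ∈ Set.Icc (0 : ℝ) (dist z (u n)) := ⟨dist_nonneg, le_rfl⟩
  have e1 := hf 1 m1 0 m0
  have e2 := hf 1 m1 _ m2
  rw [h0, sub_zero, abs_one] at e1
  rw [h1, abs_sub_comm, abs_of_nonneg (by linarith)] at e2
  have a1 := hn (f 1) (by simp [e1])
  have a2 := hn z (by simp)
  simp only [busemannCM, ContinuousMap.coe_mk, Real.dist_eq, e1, e2, dist_self] at a1 a2
  rw [abs_lt] at a1 a2
  linarith [a1.2, a2.1]

section Action

variable {Y : Type*} [MetricSpace Y] {G : Type*} [Group G] [MulAction G Y]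

lemma dist_smul_left_eq (hiso : IsometricAction G Y) (g : G) (x z : Y) :
    dist (g • x) z = dist x (g⁻¹ • z) := by
  have := (hiso g).dist_eq x (g⁻¹ • z)
  simpa using this

lemma finite_dist_smul_le (hprop : ProperAction G Y) (o y : Y) (R : ℝ) :
    Set.Finite {g : G | dist o (g • y) ≤ R} := by
  refine (hprop (Metric.closedBall o (max R (dist o y)))
    Metric.isBounded_closedBall).subset fun g hg => ?_
  refine Set.nonempty_iff_ne_empty.1 ⟨g • y, Set.smul_mem_smul_set ?_, ?_⟩
  · simp [dist_comm]
  · rw [Metric.mem_closedBall, dist_comm]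
    exact le_max_of_le_left hg

lemma horoAct_busemannCM [ContinuousConstSMul G Y] (hiso : IsometricAction G Y) (o z : Y) (g : G) :
    horoAct o g (busemannCM o z) = busemannCM o (g • z) := by
  ext x
  have h : ∀ x : Y, dist (g⁻¹ • x) z = dist x (g • z) := fun x => by
    simpa using dist_smul_left_eq hiso g⁻¹ x z
  simp [horoAct, busemannCM, h]

lemma continuous_horoAct [ContinuousConstSMul G Y] (o : Y) (g : G) :
    Continuous (horoAct o g : C(Y, ℝ) → C(Y, ℝ)) := by
  have h : (horoAct o g : C(Y, ℝ) → C(Y, ℝ)) = fun ξ =>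
      ξ.comp ⟨fun x => g⁻¹ • x, continuous_const_smul g⁻¹⟩ -
        ContinuousMap.const Y (ξ (g⁻¹ • o)) := by
    ext ξ x
    simp [horoAct]
  rw [h]
  refine (ContinuousMap.continuous_precomp _).sub ?_
  exact ContinuousMap.continuous_const'.comp (ContinuousEvalConst.continuous_eval_const _)

/-! ### The Poincaré series -/

lemma orbitCount_univ_eq (hprop : ProperAction G Y) (o : Y) (R : ℝ) :
    orbitCount G o Set.univ R = (finite_dist_smul_le (G := G) hprop o o R).toFinset.card := by
  rw [← Set.ncard_eq_toFinset_card _ (finite_dist_smul_le hprop o o R), ← Nat.card_coe_set_eq]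
  exact Nat.card_congr (Equiv.subtypeEquivRight fun g => by simp)

lemma one_le_orbitCount (hprop : ProperAction G Y) (o : Y) {R : ℝ} (hR : 0 ≤ R) :
    1 ≤ orbitCount G o Set.univ R := by
  rw [orbitCount_univ_eq hprop, Nat.one_le_iff_ne_zero, Finset.card_ne_zero]
  exact ⟨1, by simpa using hR⟩

lemma summable_exp_of_critExp_lt (hprop : ProperAction G Y) (o : Y)
    (hfin : Filter.IsBoundedUnder (· ≤ ·) atTop
      (fun R : ℝ => Real.log (orbitCount G o (Set.univ : Set G) R) / R))
    {s : ℝ} (hs0 : 0 < s) (hs : critExp G o (Set.univ : Set G) < s) :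
    Summable fun g : G => Real.exp (-s * dist o (g • o)) := by
  obtain ⟨t, ht, hts⟩ := exists_between hs
  have hev := eventually_lt_of_limsup_lt ht hfin
  have hcount : ∀ᶠ n : ℕ in atTop,
      (orbitCount G o (Set.univ : Set G) n : ℝ) * Real.exp (-s * n) ≤ Real.exp (-(s - t)) ^ n := by
    filter_upwards [tendsto_natCast_atTop_atTop.eventually hev, eventually_gt_atTop 0] with n hn hn0
    have hn0' : (0 : ℝ) < n := by exact_mod_cast hn0
    have hpos : (0 : ℝ) < orbitCount G o (Set.univ : Set G) n := by
      exact_mod_cast one_le_orbitCount hprop o hn0'.le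
    rw [div_lt_iff₀ hn0', Real.log_lt_iff_lt_exp hpos] at hn
    calc _ ≤ Real.exp (t * n) * Real.exp (-s * n) := by gcongr
      _ = _ := by rw [← Real.exp_add, ← Real.exp_nat_mul]; ring_nf
  have hsum : Summable fun n : ℕ =>
      (orbitCount G o (Set.univ : Set G) n : ℝ) * Real.exp (-s * n) := by
    refine Summable.of_norm_bounded_eventually_nat
      (summable_geometric_of_lt_one (Real.exp_pos (-(s - t))).le ?_) ?_
    · rw [Real.exp_lt_one_iff]; linarith
    · filter_upwards [hcount] with n hn
      rwa [Real.norm_of_nonneg (by positivity)]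
  set c : G → ℕ → ENNReal := fun g n =>
    if dist o (g • o) ≤ n then ENNReal.ofReal (Real.exp s * Real.exp (-s * n)) else 0 with hc
  have hle : ∀ g : G, ENNReal.ofReal (Real.exp (-s * dist o (g • o))) ≤ ∑' n, c g n := fun g => by
    refine le_trans ?_ (ENNReal.le_tsum ⌈dist o (g • o)⌉₊)
    rw [hc]
    simp only [Nat.le_ceil, if_true]
    refine ENNReal.ofReal_le_ofReal ?_
    rw [← Real.exp_add, Real.exp_le_exp]
    nlinarith [(Nat.ceil_lt_add_one (dist_nonneg (x := o) (y := g • o)))]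
  have hcol : ∀ n : ℕ, ∑' g, c g n = ENNReal.ofReal
      (Real.exp s * ((orbitCount G o (Set.univ : Set G) n : ℝ) * Real.exp (-s * n))) := fun n => by
    rw [tsum_eq_sum (s := (finite_dist_smul_le (G := G) hprop o o n).toFinset)
      (fun g hg => by simp only [Set.Finite.mem_toFinset, Set.mem_ofPred_eq] at hg; simp [hc, hg]),
      Finset.sum_congr rfl (g := fun _ => ENNReal.ofReal (Real.exp s * Real.exp (-s * n)))
      (fun g hg => by simp only [Set.Finite.mem_toFinset, Set.mem_ofPred_eq] at hg; simp [hc, hg]),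
      Finset.sum_const, orbitCount_univ_eq hprop, nsmul_eq_mul, ← ENNReal.ofReal_natCast,
      ← ENNReal.ofReal_mul (by positivity)]
    ring_nf
  have hfinite : ∑' g : G, ENNReal.ofReal (Real.exp (-s * dist o (g • o))) ≠ ⊤ := by
    refine ne_top_of_le_ne_top ?_ (ENNReal.tsum_le_tsum hle)
    rw [ENNReal.tsum_comm]
    simp_rw [hcol]
    exact (hsum.mul_left _).tsum_ofReal_ne_top
  refine (ENNReal.summable_toReal hfinite).congr fun g => ?_
  rw [ENNReal.toReal_ofReal (Real.exp_pos _).le]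

lemma critExp_nonneg (hprop : ProperAction G Y) (o : Y)
    (hfin : Filter.IsBoundedUnder (· ≤ ·) atTop
      (fun R : ℝ => Real.log (orbitCount G o (Set.univ : Set G) R) / R)) :
    0 ≤ critExp G o (Set.univ : Set G) := by
  refine le_limsup_of_frequently_le (Eventually.frequently ?_) hfin
  filter_upwards [eventually_ge_atTop 0] with R hR
  exact div_nonneg (Real.log_nonneg (by exact_mod_cast one_le_orbitCount hprop o hR)) hR

lemma not_summable_exp_of_lt_critExp [Infinite G] (hprop : ProperAction G Y) (o : Y)
    {s : ℝ} (hs : s < critExp G o (Set.univ : Set G)) :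
    ¬ Summable fun g : G => Real.exp (-s * dist o (g • o)) := by
  intro hsum
  rcases lt_or_ge s 0 with h0 | h0
  · have h1 : ∀ᶠ g : G in cofinite, Real.exp (-s * dist o (g • o)) < 1 :=
      hsum.tendsto_cofinite_zero.eventually_lt_const one_pos
    obtain ⟨g, hg⟩ := h1.exists
    rw [Real.exp_lt_one_iff] at hg
    nlinarith [dist_nonneg (x := o) (y := g • o)]
  · set S := ∑' g : G, Real.exp (-s * dist o (g • o)) with hS
    have hSpos : 0 < S := hsum.tsum_pos (fun g => (Real.exp_pos _).le) 1 (Real.exp_pos _)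
    have hbound : ∀ R : ℝ, 0 < R →
        Real.log (orbitCount G o (Set.univ : Set G) R) / R ≤ Real.log S / R + s := fun R hR => by
      have hpos : (0 : ℝ) < orbitCount G o (Set.univ : Set G) R := by
        exact_mod_cast one_le_orbitCount hprop o hR.le
      have h1 : (orbitCount G o (Set.univ : Set G) R : ℝ) * Real.exp (-s * R) ≤ S := by
        rw [orbitCount_univ_eq hprop, ← nsmul_eq_mul]
        refine le_trans (Finset.card_nsmul_le_sum _ _ _ fun g hg => ?_)
          (hsum.sum_le_tsum _ fun g _ => (Real.exp_pos _).le)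
        simp only [Set.Finite.mem_toFinset, Set.mem_ofPred_eq] at hg
        rw [Real.exp_le_exp]
        nlinarith
      have h2 := Real.log_le_log (by positivity) h1
      rw [Real.log_mul hpos.ne' (Real.exp_pos _).ne', Real.log_exp] at h2
      rw [div_add' _ _ _ hR.ne']
      gcongr
      linarith
    have hlim : Tendsto (fun R : ℝ => Real.log S / R + s) atTop (nhds (0 + s)) :=
      (tendsto_const_nhds.div_atTop tendsto_id).add_const s
    rw [zero_add] at hlim
    refine absurd hs (not_lt.2 ?_)
    rw [critExp, ← hlim.limsup_eq]
    refine limsup_le_limsup ?_ ?_ hlim.isBoundedUnder_le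
    · filter_upwards [eventually_gt_atTop 0] with R hR using hbound R hR
    · refine Filter.IsCoboundedUnder.of_frequently_ge (a := 0) (Eventually.frequently ?_)
      filter_upwards [eventually_ge_atTop 0] with R hR
      exact div_nonneg (Real.log_nonneg (by exact_mod_cast one_le_orbitCount hprop o hR)) hR

/-- The convergence of the Poincaré series does not depend on the choice of the orbit. -/
lemma summable_exp_of_summable_exp (hiso : IsometricAction G Y) {o x y : Y} {s : ℝ}
    (h : Summable fun g : G => Real.exp (-s * dist o (g • x))) :
    Summable fun g : G => Real.exp (-s * dist o (g • y)) := by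
  refine Summable.of_nonneg_of_le (fun g => (Real.exp_pos _).le) (fun g => ?_)
    (h.mul_left (Real.exp (|s| * dist x y)))
  rw [← Real.exp_add, Real.exp_le_exp]
  have h1 : |dist o (g • x) - dist o (g • y)| ≤ dist x y := by
    rw [← (hiso g).dist_eq x y, dist_comm o, dist_comm o]
    exact abs_dist_sub_le _ _ _
  have h2 : s * (dist o (g • x) - dist o (g • y)) ≤ |s| * dist x y :=
    (le_abs_self _).trans (by rw [abs_mul]; gcongr)
  linarith

/-! ### Patterson weights -/

/-- A perturbation of `r ↦ e^{-ω r}` which makes the Poincaré series at the critical exponent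
convergent, with a sum that is arbitrarily large as `C → ∞`. -/
def pattersonWeight (ω ε C r : ℝ) : ℝ :=
  min (Real.exp (-(ω - ε) * r)) (C * Real.exp (-(ω + ε) * r))

lemma pattersonWeight_pos {ω ε C : ℝ} (hC : 0 < C) (r : ℝ) : 0 < pattersonWeight ω ε C r :=
  lt_min (Real.exp_pos _) (by positivity)

lemma pattersonWeight_le {ω ε C : ℝ} (hε : 0 ≤ ε) (hC : 0 < C) (r r' : ℝ) :
    pattersonWeight ω ε C r' ≤
      Real.exp (ε * |r' - r|) * (Real.exp (-ω * (r' - r)) * pattersonWeight ω ε C r) := by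
  have h1 : ε * (r' - r) ≤ ε * |r' - r| := by gcongr; exact le_abs_self _
  have h2 : -(ε * (r' - r)) ≤ ε * |r' - r| := by
    rw [← mul_neg]; gcongr; exact neg_le_abs _
  rw [pattersonWeight, pattersonWeight, ← mul_assoc, mul_min_of_nonneg _ _ (by positivity)]
  refine min_le_min ?_ ?_
  · rw [← Real.exp_add, ← Real.exp_add, Real.exp_le_exp]
    linarith
  · rw [mul_left_comm, ← Real.exp_add, ← Real.exp_add]
    gcongr
    linarith

lemma exists_pattersonWeight_tsum {ι : Type*} {d : ι → ℝ} {ω ε : ℝ}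
    (hconv : Summable fun i => Real.exp (-(ω + ε) * d i))
    (hdiv : ¬ Summable fun i => Real.exp (-(ω - ε) * d i)) (M : ℝ) :
    ∃ C : ℝ, 0 < C ∧ ENNReal.ofReal M ≤ ∑' i, ENNReal.ofReal (pattersonWeight ω ε C (d i)) ∧
      ∑' i, ENNReal.ofReal (pattersonWeight ω ε C (d i)) ≠ ⊤ := by
  obtain ⟨F, hF⟩ : ∃ F : Finset ι, M < ∑ i ∈ F, Real.exp (-(ω - ε) * d i) := by
    by_contra! h
    exact hdiv (summable_of_sum_le (fun i => (Real.exp_pos _).le) h)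
  obtain ⟨C, hC⟩ := (F.finite_toSet.image fun i => Real.exp (2 * ε * d i)).bddAbove
  refine ⟨max C 1, lt_max_of_lt_right one_pos, ?_, ?_⟩
  · calc ENNReal.ofReal M ≤ ENNReal.ofReal (∑ i ∈ F, pattersonWeight ω ε (max C 1) (d i)) := by
          refine ENNReal.ofReal_le_ofReal (hF.le.trans (Finset.sum_le_sum fun i hi => ?_))
          refine le_min le_rfl ?_
          calc Real.exp (-(ω - ε) * d i)
              = Real.exp (2 * ε * d i) * Real.exp (-(ω + ε) * d i) := by
                rw [← Real.exp_add]; ring_nf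
            _ ≤ _ := by
                gcongr
                exact le_max_of_le_left (hC ⟨i, hi, rfl⟩)
      _ = ∑ i ∈ F, ENNReal.ofReal (pattersonWeight ω ε (max C 1) (d i)) :=
          ENNReal.ofReal_sum_of_nonneg fun i _ =>
            (pattersonWeight_pos (lt_max_of_lt_right one_pos) _).le
      _ ≤ _ := ENNReal.sum_le_tsum _
  · refine ne_top_of_le_ne_top (hconv.mul_left (max C 1)).tsum_ofReal_ne_top
      (ENNReal.tsum_le_tsum fun i => ENNReal.ofReal_le_ofReal (min_le_right _ _))

/-! ### The limit measure -/

/-- The atomic measure with weight `w (d(o, g y))` at the point `g y`, normalized. -/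
def orbitMeasure (G : Type*) {Y : Type*} [MetricSpace Y] [Group G] [MulAction G Y]
    [MeasurableSpace C(Y, ℝ)] (o y : Y) (w : ℝ → ℝ) : Measure C(Y, ℝ) :=
  (∑' g : G, ENNReal.ofReal (w (dist o (g • y))))⁻¹ •
    Measure.sum fun g : G =>
      ENNReal.ofReal (w (dist o (g • y))) • Measure.dirac (busemannCM o (g • y))

section OrbitMeasure

variable [MeasurableSpace C(Y, ℝ)]

lemma lintegral_orbitMeasure (o y : Y) (w : ℝ → ℝ) {f : C(Y, ℝ) → ENNReal} (hf : Measurable f) :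
    ∫⁻ ξ, f ξ ∂(orbitMeasure G o y w) = (∑' g : G, ENNReal.ofReal (w (dist o (g • y))))⁻¹ *
      ∑' g : G, ENNReal.ofReal (w (dist o (g • y))) * f (busemannCM o (g • y)) := by
  rw [orbitMeasure, lintegral_smul_measure, lintegral_sum_measure, smul_eq_mul]
  congr 1
  refine tsum_congr fun g => ?_
  rw [lintegral_smul_measure, lintegral_dirac' _ hf, smul_eq_mul]

lemma orbitMeasure_apply (o y : Y) (w : ℝ → ℝ) {s : Set C(Y, ℝ)} (hs : MeasurableSet s) :
    orbitMeasure G o y w s = (∑' g : G, ENNReal.ofReal (w (dist o (g • y))))⁻¹ *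
      ∑' g : G, ENNReal.ofReal (w (dist o (g • y))) * s.indicator 1 (busemannCM o (g • y)) := by
  rw [← lintegral_orbitMeasure o y w (measurable_one.indicator hs), lintegral_indicator_one hs]

lemma isProbabilityMeasure_orbitMeasure (o y : Y) {w : ℝ → ℝ}
    (h0 : ∑' g : G, ENNReal.ofReal (w (dist o (g • y))) ≠ 0)
    (htop : ∑' g : G, ENNReal.ofReal (w (dist o (g • y))) ≠ ⊤) :
    IsProbabilityMeasure (orbitMeasure G o y w) := by
  constructor
  rw [orbitMeasure_apply o y w MeasurableSet.univ]
  simpa using ENNReal.inv_mul_cancel h0 htop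

variable [BorelSpace C(Y, ℝ)]

lemma orbitMeasure_compl_horoCpt (o y : Y) (w : ℝ → ℝ) :
    orbitMeasure G o y w (horoCpt Y o)ᶜ = 0 := by
  rw [orbitMeasure_apply o y w (s := (horoCpt Y o)ᶜ) isClosed_closure.measurableSet.compl]
  have h : ∀ g : G, busemannCM o (g • y) ∈ horoCpt Y o := fun g => subset_closure ⟨_, rfl⟩
  simp [h]

/-- The measure with weight `pattersonWeight ω ε C` is quasi-invariant under `g`, with conformal
factor `e^{-ω ξ(g o)}`, up to a multiplicative error `e^{ε d(o, g o)}`. -/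
lemma lintegral_orbitMeasure_comp_horoAct_le [ContinuousConstSMul G Y] (hiso : IsometricAction G Y)
    (o y : Y) {ω ε C : ℝ} (hε : 0 ≤ ε) (hC : 0 < C) (g : G) {f e : C(Y, ℝ) → ENNReal}
    (hf : Measurable f) (he : Measurable e)
    (hexp : ∀ k : G, e (busemannCM o (k • y)) =
      ENNReal.ofReal (Real.exp (-ω * busemannCM o (k • y) (g • o)))) :
    (∫⁻ ξ, f (horoAct o g ξ) ∂(orbitMeasure G o y (pattersonWeight ω ε C)) ≤
        ENNReal.ofReal (Real.exp (ε * dist o (g • o))) *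
          ∫⁻ ξ, e ξ * f ξ ∂(orbitMeasure G o y (pattersonWeight ω ε C))) ∧
      ∫⁻ ξ, e ξ * f ξ ∂(orbitMeasure G o y (pattersonWeight ω ε C)) ≤
        ENNReal.ofReal (Real.exp (ε * dist o (g • o))) *
          ∫⁻ ξ, f (horoAct o g ξ) ∂(orbitMeasure G o y (pattersonWeight ω ε C)) := by
  have hb : ∀ k : G, |dist (g • o) (k • y) - dist o (k • y)| ≤ dist o (g • o) := fun k => by
    rw [dist_comm o (g • o)]; exact abs_dist_sub_le _ _ _
  have hL : ∑' k : G, ENNReal.ofReal (pattersonWeight ω ε C (dist o (k • y))) *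
        f (horoAct o g (busemannCM o (k • y))) =
      ∑' k : G, ENNReal.ofReal (pattersonWeight ω ε C (dist (g • o) (k • y))) *
        f (busemannCM o (k • y)) := by
    rw [← (Equiv.mulLeft g).tsum_eq fun k => ENNReal.ofReal
      (pattersonWeight ω ε C (dist (g • o) (k • y))) * f (busemannCM o (k • y))]
    refine tsum_congr fun k => ?_
    rw [horoAct_busemannCM hiso, Equiv.coe_mulLeft, mul_smul, (hiso g).dist_eq]
  rw [lintegral_orbitMeasure o y _ (f := fun ξ => f (horoAct o g ξ))
      (hf.comp (continuous_horoAct o g).measurable),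
    lintegral_orbitMeasure o y _ (f := fun ξ => e ξ * f ξ) (he.mul hf), hL]
  simp only [hexp]
  set D : ENNReal := ENNReal.ofReal (Real.exp (ε * dist o (g • o)))
  rw [mul_left_comm D, mul_left_comm D, ← ENNReal.tsum_mul_left (a := D),
    ← ENNReal.tsum_mul_left (a := D)]
  refine ⟨mul_le_mul_right (ENNReal.tsum_le_tsum fun k => ?_) _,
    mul_le_mul_right (ENNReal.tsum_le_tsum fun k => ?_) _⟩
  · rw [← mul_assoc, ← mul_assoc]
    refine mul_le_mul_left ?_ _
    rw [← ENNReal.ofReal_mul (by positivity),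
      ← ENNReal.ofReal_mul (mul_nonneg (Real.exp_pos _).le (pattersonWeight_pos hC _).le)]
    refine ENNReal.ofReal_le_ofReal ?_
    refine (pattersonWeight_le hε hC (dist o (k • y)) (dist (g • o) (k • y))).trans ?_
    rw [mul_assoc, mul_comm (pattersonWeight _ _ _ _)]
    refine mul_le_mul_of_nonneg_right ?_
      (mul_nonneg (Real.exp_pos _).le (pattersonWeight_pos hC _).le)
    rw [Real.exp_le_exp]
    exact mul_le_mul_of_nonneg_left (hb k) hε
  · rw [← mul_assoc, ← mul_assoc]
    refine mul_le_mul_left ?_ _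
    rw [show D = ENNReal.ofReal _ from rfl, ← ENNReal.ofReal_mul (Real.exp_pos _).le,
      ← ENNReal.ofReal_mul (pattersonWeight_pos hC _).le]
    refine ENNReal.ofReal_le_ofReal ?_
    have h := pattersonWeight_le (ω := ω) hε hC (dist (g • o) (k • y)) (dist o (k • y))
    set a := dist o (k • y)
    set b := dist (g • o) (k • y)
    have hba : busemannCM o (k • y) (g • o) = b - a := rfl
    rw [hba]
    calc pattersonWeight ω ε C a * Real.exp (-ω * (b - a))
        ≤ Real.exp (ε * |a - b|) * (Real.exp (-ω * (a - b)) * pattersonWeight ω ε C b) *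
          Real.exp (-ω * (b - a)) := by gcongr
      _ = Real.exp (ε * |a - b|) * pattersonWeight ω ε C b *
          (Real.exp (-ω * (a - b)) * Real.exp (-ω * (b - a))) := by ring
      _ = Real.exp (ε * |a - b|) * pattersonWeight ω ε C b := by
          rw [← Real.exp_add]; ring_nf; simp
      _ ≤ _ := by
          refine mul_le_mul_of_nonneg_right ?_ (pattersonWeight_pos hC _).le
          rw [Real.exp_le_exp, abs_sub_comm]
          exact mul_le_mul_of_nonneg_left (hb k) hε

/-- If the Poincaré series has exponent `ω`, weak limits of the orbit measures at the critical
exponent are supported on the limit set and quasi-invariant. -/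
lemma exists_isProbabilityMeasure_map_horoAct [ProperSpace Y]
    [ContinuousConstSMul G Y] (hY : GeodesicSpace Y) (hiso : IsometricAction G Y)
    (hprop : ProperAction G Y) (o y : Y) {ω : ℝ}
    (hconv : ∀ s, ω < s → Summable fun g : G => Real.exp (-s * dist o (g • y)))
    (hdiv : ∀ s, s < ω → ¬ Summable fun g : G => Real.exp (-s * dist o (g • y))) :
    ∃ μ : Measure C(Y, ℝ), IsProbabilityMeasure μ ∧ μ (horoCpt Y o)ᶜ = 0 ∧
      μ (orbitLimitSet G o y)ᶜ = 0 ∧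
      ∀ g : G, μ.map (horoAct o g) =
        μ.withDensity fun ξ => ENNReal.ofReal (Real.exp (-ω * ξ (g • o))) := by
  set ε : ℕ → ℝ := fun n => 1 / ((n : ℝ) + 1) with hε
  have hεpos : ∀ n, 0 < ε n := fun n => Nat.one_div_pos_of_nat
  have hεlim : Tendsto ε atTop (nhds 0) := tendsto_one_div_add_atTop_nhds_zero_nat
  choose C hC hlarge htop using fun n : ℕ => exists_pattersonWeight_tsum (ω := ω) (ε := ε n)
    (hconv _ (lt_add_of_pos_right _ (hεpos n))) (hdiv _ (sub_lt_self _ (hεpos n))) ((n : ℝ) + 1)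
  set w : ℕ → ℝ → ℝ := fun n => pattersonWeight ω (ε n) (C n) with hw
  have hne : ∀ n, ∑' g : G, ENNReal.ofReal (w n (dist o (g • y))) ≠ 0 := fun n =>
    ((ENNReal.ofReal_pos.2 (by positivity)).trans_le (hlarge n)).ne'
  set ν : ℕ → ProbabilityMeasure C(Y, ℝ) := fun n =>
    ⟨orbitMeasure G o y (w n), isProbabilityMeasure_orbitMeasure o y (hne n) (htop n)⟩ with hν
  have htight : IsTightMeasureSet {((μ : ProbabilityMeasure C(Y, ℝ)) : Measure C(Y, ℝ)) |
      μ ∈ Set.range ν} := by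
    rw [isTightMeasureSet_iff_exists_isCompact_measure_compl_le]
    refine fun δ _ => ⟨horoCpt Y o, isCompact_horoCpt o, ?_⟩
    rintro _ ⟨_, ⟨n, rfl⟩, rfl⟩
    exact (orbitMeasure_compl_horoCpt o y (w n)).trans_le zero_le
  obtain ⟨μ, -, hμ⟩ := (isCompact_closure_of_isTightMeasureSet htight).ultrafilter_le_nhds
    (Ultrafilter.map ν (hyperfilter ℕ))
    (le_principal_iff.2 (mem_map.2 (univ_mem' fun n => subset_closure ⟨n, rfl⟩)))
  replace hμ : Tendsto ν (hyperfilter ℕ : Filter ℕ) (nhds μ) := hμ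
  have hle : ((hyperfilter ℕ : Ultrafilter ℕ) : Filter ℕ) ≤ atTop := by
    rw [← Nat.cofinite_eq_atTop]; exact hyperfilter_le_cofinite
  have hopen : ∀ U : Set C(Y, ℝ), IsOpen U →
      Tendsto (fun n => (ν n : Measure C(Y, ℝ)) U) atTop (nhds 0) →
      (μ : Measure C(Y, ℝ)) U = 0 := fun U hU hlim => by
    refine le_antisymm ?_ zero_le
    refine (ProbabilityMeasure.le_liminf_measure_open_of_tendsto hμ hU).trans ?_
    exact (hlim.mono_left hle).liminf_eq.le
  have hK : (μ : Measure C(Y, ℝ)) (horoCpt Y o)ᶜ = 0 := by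
    refine hopen _ isClosed_closure.isOpen_compl ?_
    exact tendsto_const_nhds.congr fun n => (orbitMeasure_compl_horoCpt o y (w n)).symm
  refine ⟨μ, inferInstance, hK, ?_, fun g => ?_⟩
  · set A : ℕ → Set C(Y, ℝ) := fun m =>
      closure ((fun g : G => busemannCM o (g • y)) '' {g | (m : ℝ) < dist o (g • y)}) with hA
    have hA0 : ∀ m, (μ : Measure C(Y, ℝ)) (A m)ᶜ = 0 := fun m => by
      refine hopen _ isClosed_closure.isOpen_compl ?_
      set F := (finite_dist_smul_le (G := G) hprop o y m).toFinset with hF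
      have hFmem : ∀ g, g ∉ F → busemannCM o (g • y) ∈ A m := fun g hg =>
        subset_closure ⟨g, by simpa [hF] using hg, rfl⟩
      have hbound : ∀ n, (ν n : Measure C(Y, ℝ)) (A m)ᶜ ≤
          (ENNReal.ofReal ((n : ℝ) + 1))⁻¹ *
            ENNReal.ofReal (F.card • Real.exp ((|ω| + 1) * m)) := fun n => by
        refine (orbitMeasure_apply o y (w n) isClosed_closure.measurableSet.compl).trans_le ?_
        refine mul_le_mul' (ENNReal.inv_le_inv.2 (hlarge n)) ?_
        rw [tsum_eq_sum (s := F) fun g hg => by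
            rw [Set.indicator_of_notMem (Set.notMem_compl_iff.2 (hFmem g hg)), mul_zero], ← Finset.sum_const,
          ENNReal.ofReal_sum_of_nonneg fun _ _ => (Real.exp_pos _).le]
        refine Finset.sum_le_sum fun g hg => ?_
        have hgm : dist o (g • y) ≤ m := by simpa [hF] using hg
        calc _ ≤ ENNReal.ofReal (w n (dist o (g • y))) * 1 := by
              gcongr
              exact Set.indicator_le_self _ _ _
          _ ≤ _ := by
              rw [mul_one]
              refine ENNReal.ofReal_le_ofReal ((min_le_left _ _).trans (Real.exp_le_exp.2 ?_))
              have h1 : ε n ≤ 1 := by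
                rw [hε]
                exact div_le_one_of_le₀ (by linarith [n.cast_nonneg (α := ℝ)]) (by positivity)
              have h2 : -(ω - ε n) ≤ |ω| + 1 := by linarith [neg_le_abs ω]
              exact (mul_le_mul_of_nonneg_right h2 dist_nonneg).trans (by gcongr)
      refine tendsto_of_tendsto_of_tendsto_of_le_of_le tendsto_const_nhds ?_
        (fun _ => zero_le) hbound
      have hinv : Tendsto (fun n : ℕ => (ENNReal.ofReal ((n : ℝ) + 1))⁻¹) atTop (nhds 0) := by
        rw [← ENNReal.inv_top]
        exact tendsto_inv_iff.2 (ENNReal.tendsto_ofReal_atTop.comp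
          (tendsto_atTop_add_const_right _ _ tendsto_natCast_atTop_atTop))
      have h := ENNReal.Tendsto.mul_const hinv (Or.inr (ENNReal.ofReal_ne_top
        (r := F.card • Real.exp ((|ω| + 1) * m))))
      rwa [zero_mul] at h
    refine measure_mono_null (t := ⋃ m, (A m)ᶜ) ?_ (measure_iUnion_null hA0)
    rw [← Set.compl_iInter, Set.compl_subset_compl]
    intro ξ hξ
    rw [Set.mem_iInter] at hξ
    obtain ⟨V, hV⟩ := (nhds ξ).exists_antitone_basis
    have hex : ∀ m : ℕ, ∃ g : G, (m : ℝ) < dist o (g • y) ∧ busemannCM o (g • y) ∈ V m :=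
      fun m => by
        obtain ⟨_, hmem, g, hg, rfl⟩ := mem_closure_iff_nhds.1 (hξ m) _ (hV.mem m)
        exact ⟨g, hg, hmem⟩
    choose u hu huV using hex
    have hlim : Tendsto (fun n => busemannCM o (u n • y)) atTop (nhds ξ) := hV.tendsto huV
    refine ⟨⟨closure_mono ?_ (hξ 0), ?_⟩, u, hlim⟩
    · rintro _ ⟨g, -, rfl⟩
      exact ⟨_, rfl⟩
    · exact ne_busemannCM_of_horoConv hY (tendsto_atTop_mono (fun n => (hu n).le)
        tendsto_natCast_atTop_atTop) hlim
  · set D := dist o (g • o)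
    -- a bounded continuous function which is the conformal factor on the compactification
    let e : BoundedContinuousFunction C(Y, ℝ) NNReal := BoundedContinuousFunction.mkOfBound
      ⟨fun ξ => (min (Real.exp (-ω * ξ (g • o))) (Real.exp (|ω| * D))).toNNReal, by fun_prop⟩
      (Real.exp (|ω| * D)) fun ξ η => by
        have h : ∀ ζ : C(Y, ℝ), 0 ≤ min (Real.exp (-ω * ζ (g • o))) (Real.exp (|ω| * D)) :=
          fun ζ => le_min (Real.exp_pos _).le (Real.exp_pos _).le
        simp only [ContinuousMap.coe_mk, NNReal.dist_eq, Real.coe_toNNReal _ (h _)]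
        exact abs_sub_le_of_nonneg_of_le (h ξ) (min_le_right _ _) (h η) (min_le_right _ _)
    have he : ∀ ξ ∈ horoCpt Y o,
        (e ξ : ENNReal) = ENNReal.ofReal (Real.exp (-ω * ξ (g • o))) := fun ξ hξ => by
      obtain ⟨h0, h1⟩ := horoCpt_subset o hξ
      have h2 := h1 (g • o) o
      rw [h0, sub_zero, dist_comm] at h2
      have h3 : -ω * ξ (g • o) ≤ |ω| * D := (le_abs_self _).trans (by
        rw [abs_mul, abs_neg]; gcongr)
      change ENNReal.ofReal (min _ _) = _
      rw [min_eq_left (Real.exp_le_exp.2 h3)]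
    have hae : ∀ᵐ ξ ∂(μ : Measure C(Y, ℝ)), ξ ∈ horoCpt Y o := hK
    have hdens : (μ : Measure C(Y, ℝ)).withDensity (fun ξ => (e ξ : ENNReal)) =
        (μ : Measure C(Y, ℝ)).withDensity
          fun ξ => ENNReal.ofReal (Real.exp (-ω * ξ (g • o))) :=
      withDensity_congr_ae (hae.mono he)
    rw [← hdens]
    have hact := continuous_horoAct (G := G) o g
    refine ext_of_forall_lintegral_eq_of_IsFiniteMeasure fun f => ?_
    have hfm : Measurable fun ξ => (f ξ : ENNReal) := by fun_prop
    have hem : Measurable fun ξ => (e ξ : ENNReal) := by fun_prop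
    rw [lintegral_map hfm hact.measurable, lintegral_withDensity_eq_lintegral_mul _ hem hfm]
    have hlim1 := ProbabilityMeasure.tendsto_iff_forall_lintegral_tendsto.1 hμ
      (f.compContinuous ⟨_, hact⟩)
    have hlim2 := ProbabilityMeasure.tendsto_iff_forall_lintegral_tendsto.1 hμ (e * f)
    have hcomp := fun n => lintegral_orbitMeasure_comp_horoAct_le hiso o y (ω := ω) (hεpos n).le
      (hC n) g hfm hem fun k => he _ (subset_closure ⟨_, rfl⟩)
    have hone : Tendsto (fun n => ENNReal.ofReal (Real.exp (ε n * D)))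
        (hyperfilter ℕ : Filter ℕ) (nhds 1) := by
      have h := (ENNReal.continuous_ofReal.tendsto _).comp
        ((Real.continuous_exp.tendsto _).comp (hεlim.mul_const D))
      simp only [zero_mul, Real.exp_zero, ENNReal.ofReal_one] at h
      exact h.mono_left hle
    have hmul : ∀ {a : ℕ → ENNReal} {b : ENNReal},
        Tendsto a (hyperfilter ℕ : Filter ℕ) (nhds b) →
        Tendsto (fun n => ENNReal.ofReal (Real.exp (ε n * D)) * a n)
          (hyperfilter ℕ : Filter ℕ) (nhds b) := fun h => by
      simpa using ENNReal.Tendsto.mul hone (Or.inl one_ne_zero) h (Or.inr ENNReal.one_ne_top)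
    simp only [BoundedContinuousFunction.coe_mul, Pi.mul_apply, ENNReal.coe_mul] at hlim2
    exact le_antisymm (le_of_tendsto_of_tendsto' hlim1 (hmul hlim2) fun n => (hcomp n).1)
      (le_of_tendsto_of_tendsto' hlim2 (hmul hlim1) fun n => (hcomp n).2)

end OrbitMeasure

end Action

end PattersonSullivan

/-- existence of Patterson–Sullivan measures: if `G` contains a contracting
element and `ω_G < ∞`, then for every `y` there is an `ω_G`-dimensional `G`-equivariant
conformal density on `∂_h Y` supported on the limit set `Λ G y`. -/
theorem statement14 {Y G : Type*} [MetricSpace Y] [ProperSpace Y]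
    [Group G] [MulAction G Y] [Countable G] [ContinuousConstSMul G Y]
    [MeasurableSpace C(Y, ℝ)] [BorelSpace C(Y, ℝ)]
    (hY : GeodesicSpace Y) (hiso : IsometricAction G Y)
    (hprop : ProperAction G Y) (hne : NonElementary G) (o : Y)
    (hcontr : ∃ f : G, IsContractingEltAny o f)
    (hfin : Filter.IsBoundedUnder (· ≤ ·) atTop
      (fun R : ℝ => Real.log (orbitCount G o (Set.univ : Set G) R) / R)) :
    ∀ y : Y, ∃ μ : Y → MeasureTheory.Measure C(Y, ℝ),
      IsConformalDensity G o (critExp G o (Set.univ : Set G)) μ ∧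
      ∀ x : Y, μ x ((orbitLimitSet G o y)ᶜ) = 0 := by
  intro y
  have : Infinite G := by
    obtain ⟨f, -, -, hf, -⟩ := hcontr
    refine Infinite.of_injective (fun n : ℤ => f ^ n) (injective_zpow_iff_not_isOfFinOrder.2
      fun h => ?_)
    obtain ⟨n, hn, hfn⟩ := isOfFinOrder_iff_zpow_eq_one.1 h
    exact hf n hn hfn
  set ω := critExp G o (Set.univ : Set G) with hω
  obtain ⟨μ, hprob, hμK, hμL, hμG⟩ := exists_isProbabilityMeasure_map_horoAct hY hiso hprop o y
    (fun s hs => summable_exp_of_summable_exp hiso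
      (summable_exp_of_critExp_lt hprop o hfin ((critExp_nonneg hprop o hfin).trans_lt hs) hs))
    (fun s hs h => not_summable_exp_of_lt_critExp hprop o hs
      (summable_exp_of_summable_exp hiso h))
  have hae : ∀ᵐ ξ ∂μ, ξ ∈ horoCpt Y o := hμK
  have hmeas : ∀ x : Y, Measurable fun ξ : C(Y, ℝ) => ENNReal.ofReal (Real.exp (-ω * ξ x)) :=
    fun x => by
      have : Continuous fun ξ : C(Y, ℝ) => Real.exp (-ω * ξ x) := by fun_prop
      exact this.measurable.ennreal_ofReal
  have hmeas2 : ∀ x z : Y, Measurable fun ξ : C(Y, ℝ) =>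
      ENNReal.ofReal (Real.exp (-ω * (ξ x - ξ z))) := fun x z => by
    have : Continuous fun ξ : C(Y, ℝ) => Real.exp (-ω * (ξ x - ξ z)) := by fun_prop
    exact this.measurable.ennreal_ofReal
  set ν : Y → Measure C(Y, ℝ) := fun x =>
    μ.withDensity fun ξ => ENNReal.ofReal (Real.exp (-ω * ξ x)) with hν
  have hac : ∀ (x : Y) {s : Set C(Y, ℝ)}, μ s = 0 → ν x s = 0 := fun x s hs =>
    withDensity_absolutelyContinuous _ _ hs
  have hdens : ∀ x z : Y, ν x = (ν z).withDensity
      fun ξ => ENNReal.ofReal (Real.exp (-ω * (ξ x - ξ z))) := fun x z => by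
    rw [hν, ← withDensity_mul _ (hmeas z) (hmeas2 x z)]
    refine congrArg _ (funext fun ξ => ?_)
    rw [Pi.mul_apply, ← ENNReal.ofReal_mul (Real.exp_pos _).le, ← Real.exp_add]
    ring_nf
  refine ⟨ν, ⟨fun x => ?_, fun x => ?_, ?_, fun g x => ?_, hdens⟩, fun x => hac x hμL⟩
  · refine isFiniteMeasure_withDensity (ne_top_of_le_ne_top
      (b := ENNReal.ofReal (Real.exp (|ω| * dist x o))) ENNReal.ofReal_ne_top ?_)
    calc ∫⁻ ξ, ENNReal.ofReal (Real.exp (-ω * ξ x)) ∂μ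
        ≤ ∫⁻ _, ENNReal.ofReal (Real.exp (|ω| * dist x o)) ∂μ := by
          refine lintegral_mono_ae (hae.mono fun ξ hξ => ENNReal.ofReal_le_ofReal ?_)
          obtain ⟨h0, h1⟩ := horoCpt_subset o hξ
          have h2 := h1 x o
          rw [h0, sub_zero] at h2
          refine Real.exp_le_exp.2 ((le_abs_self _).trans ?_)
          rw [abs_mul, abs_neg]
          gcongr
      _ = _ := by simp
  · exact hac x (measure_mono_null (t := (orbitLimitSet G o y)ᶜ)
      (Set.compl_subset_compl.2 fun ξ hξ => hξ.1) hμL)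
  · have h : ν o = μ := by
      rw [hν]
      refine (withDensity_congr_ae (hae.mono fun ξ hξ => ?_)).trans withDensity_one
      simp [(horoCpt_subset o hξ).1]
    rw [h, measure_univ]
  · have hpull : ν x = μ.withDensity fun ξ => ENNReal.ofReal
        (Real.exp (-ω * (horoAct o g ξ (g • x) - horoAct o g ξ (g • o)))) := by
      refine withDensity_congr_ae (hae.mono fun ξ hξ => ?_)
      simp [horoAct, (horoCpt_subset o hξ).1]
    have hT := (continuous_horoAct (Y := Y) o g).measurable
    have hmap : Measure.map (horoAct o g) (ν x) = (Measure.map (horoAct o g) μ).withDensity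
        fun ξ => ENNReal.ofReal (Real.exp (-ω * (ξ (g • x) - ξ (g • o)))) := by
      ext s hs
      rw [hpull, Measure.map_apply hT hs, withDensity_apply _ (hT hs), withDensity_apply _ hs,
        setLIntegral_map hs (hmeas2 _ _) hT]
    rw [hmap, hμG]
    exact (hdens (g • x) (g • o)).symm

end ConfDyn
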